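/- arXiv:2208.09890 — 2 statements merged into one kernel-verified Lean document; each statement's English description precedes it below -/
import Mathlib

section
/- Let K be a field and n ≥ 0 an integer, and let h_0, …, h_n ∈ K[x_0, …, x_n] be homogeneous polynomials of positive degrees whose only common zero in K̄^{n+1} (K̄ an algebraic closure of K) is the origin, i.e., they have no common zero in ℙ^n over K̄. For each integer ℓ ≥ 0 set δ_ℓ := dim_K K[x_0,…,x_n]_ℓ / ⟨h_0, …, h_n⟩_ℓ, the K-dimension of the degree-ℓ graded piece of the quotient of the polynomial ring by the ideal generated by h_0,…,h_n. Then for every ℓ ≥ 0, δ_ℓ equals the coefficient of t^ℓ in the polynomial ∏_{i=0}^n (1 + t + ⋯ + t^{deg h_i − 1}) ∈ ℤ[t]. -/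
open MvPolynomial

section

open RingTheory.Sequence IsLocalRing

variable {R : Type*} [CommRing R]

theorem RingTheory.Sequence.IsWeaklyRegular.append_singleton_of_mem_radical {c : List R} {a w : R}
    (hc : IsWeaklyRegular R (c ++ [a])) (ha : a ∈ (Ideal.ofList (c ++ [w])).radical) :
    IsWeaklyRegular R (c ++ [w]) := by
  rw [isWeaklyRegular_append_iff, isWeaklyRegular_singleton_iff] at hc ⊢
  refine ⟨hc.1, ?_⟩
  obtain ⟨k, hk⟩ := ha
  rw [Ideal.ofList_append, Ideal.ofList_singleton] at hk
  obtain ⟨y, hy, v, hv, hyv⟩ := Submodule.mem_sup.1 hk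
  obtain ⟨z, rfl⟩ := Ideal.mem_span_singleton.1 hv
  rw [isSMulRegular_quotient_iff_mem_of_smul_mem]
  intro x hx
  refine mem_of_isSMulRegular_quotient_of_smul_mem (hc.2.pow k) ?_
  simp only [smul_eq_mul, Ideal.mul_top] at hx ⊢
  rw [← hyv, add_mul]
  refine add_mem (Ideal.mul_mem_right _ _ hy) ?_
  rw [mul_comm w, mul_assoc]
  exact Ideal.mul_mem_left _ _ hx

variable [IsLocalRing R] [IsNoetherianRing R]

theorem IsLocalRing.maximalIdeal_notMem_minimalPrimes_ofList {c : List R}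
    (hc : c.length < (maximalIdeal R).height) :
    maximalIdeal R ∉ (Ideal.ofList c).minimalPrimes := by
  classical
  intro h
  have h' : maximalIdeal R ∈ (Ideal.span (c.toFinset : Set R)).minimalPrimes := by
    simpa [Ideal.ofList] using h
  refine absurd (Ideal.height_le_card_of_mem_minimalPrimes_span_finset h') (not_le.2 ?_)
  exact lt_of_le_of_lt (by exact_mod_cast c.toFinset_card_le) hc

theorem IsLocalRing.maximalIdeal_le_radical_ofList_append_singleton {c : List R} {b w : R}
    (hcm : ∀ x ∈ c, x ∈ maximalIdeal R) (hb : b ∈ maximalIdeal R)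
    (hrad : maximalIdeal R ≤ (Ideal.ofList (c ++ [b])).radical)
    (hw : ∀ p ∈ (Ideal.ofList c).minimalPrimes, w ∉ p) :
    maximalIdeal R ≤ (Ideal.ofList (c ++ [w])).radical := by
  rw [Ideal.radical_eq_sInf]
  refine le_sInf fun P hP ↦ ?_
  obtain ⟨hP, hPp⟩ := hP
  by_contra hne
  have hlt : P < maximalIdeal R :=
    lt_of_le_of_ne (le_maximalIdeal hPp.ne_top) fun h ↦ hne h.ge
  have hcP : {x | x ∈ c} ⊆ (P : Set R) := fun x hx ↦
    hP (Ideal.subset_span (by simp only [List.mem_append]; exact Or.inl hx))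
  have hwP : w ∈ P := hP (Ideal.subset_span (by simp))
  have heq : Ideal.ofList (c ++ [b]) = Ideal.span (insert b {x | x ∈ c}) := by
    unfold Ideal.ofList
    congr 1
    ext; simp [or_comm]
  refine hw P (Ideal.mem_minimalPrimes_span_of_mem_minimalPrimes_span_insert hlt b {x | x ∈ c} ?_
    {x | x ∈ c} hcP ?_) hwP
  · rw [← heq]
    refine ⟨⟨inferInstance, ?_⟩, fun Q hQ _ ↦ ?_⟩
    · refine Ideal.span_le.2 fun x hx ↦ ?_
      rcases List.mem_append.1 hx with h | h
      · exact hcm x h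
      · rw [List.mem_singleton.1 h]; exact hb
    · exact hrad.trans (hQ.1.radical_le_iff.2 hQ.2)
  · exact fun x hx ↦ Ideal.le_radical (Ideal.subset_span (Set.mem_insert_of_mem _ hx))

theorem IsLocalRing.exists_mem_maximalIdeal_forall_notMem_minimalPrimes (I J : Ideal R)
    (hI : maximalIdeal R ∉ I.minimalPrimes) (hJ : maximalIdeal R ∉ J.minimalPrimes) :
    ∃ w ∈ maximalIdeal R, (∀ p ∈ I.minimalPrimes, w ∉ p) ∧ ∀ p ∈ J.minimalPrimes, w ∉ p := by
  by_contra! hcon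
  have hfin : (I.minimalPrimes ∪ J.minimalPrimes).Finite :=
    I.finite_minimalPrimes_of_isNoetherianRing.union J.finite_minimalPrimes_of_isNoetherianRing
  have hsub : (maximalIdeal R : Set R) ⊆ ⋃ p ∈ I.minimalPrimes ∪ J.minimalPrimes, (p : Set R) := by
    intro w hw
    simp only [Set.mem_iUnion, Set.mem_union, exists_prop]
    by_cases h : ∀ p ∈ I.minimalPrimes, w ∉ p
    · obtain ⟨p, hp, hwp⟩ := hcon w hw h
      exact ⟨p, Or.inr hp, hwp⟩
    · push Not at h
      obtain ⟨p, hp, hwp⟩ := h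
      exact ⟨p, Or.inl hp, hwp⟩
  have hprime : ∀ p ∈ I.minimalPrimes ∪ J.minimalPrimes, p.IsPrime := by
    rintro p (hp | hp) <;> exact hp.1.1
  obtain ⟨p, hp, hle⟩ := (Ideal.subset_union_prime_finite hfin (f := id) ⊥ ⊥
    fun p hp _ _ ↦ hprime p hp).1 hsub
  have : p = maximalIdeal R := le_antisymm (le_maximalIdeal (hprime p hp).ne_top) hle
  subst this
  exact hp.elim hI hJ

theorem IsLocalRing.length_le_height_maximalIdeal_of_isWeaklyRegular {l : List R}
    (hl : ∀ x ∈ l, x ∈ maximalIdeal R) (hreg : IsWeaklyRegular R l) :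
    (l.length : ℕ∞) ≤ (maximalIdeal R).height := by
  have hreg' := IsRegular.of_isWeaklyRegular_of_mem_maximalIdeal R hl hreg
  have hle : Ideal.ofList l ≤ maximalIdeal R := Ideal.span_le.2 hl
  have : Nontrivial (R ⧸ Ideal.ofList l) := Ideal.Quotient.nontrivial_iff.2
    (ne_top_of_le_ne_top (maximalIdeal.isMaximal R).ne_top hle)
  have hdim := ringKrullDim_add_length_eq_ringKrullDim_of_isRegular l hreg'
  rw [← maximalIdeal_height_eq_ringKrullDim (R := R)] at hdim
  have h0 : (l.length : WithBot ℕ∞) ≤ ((maximalIdeal R).height : WithBot ℕ∞) := by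
    rw [← hdim]
    exact le_add_of_nonneg_left ringKrullDim_nonneg_of_nontrivial
  exact_mod_cast h0

/-- In a Noetherian local ring, if `g ++ a` is a system of parameters forming a regular sequence,
then so is every system of parameters `g ++ b` of the same length. -/
theorem IsLocalRing.isWeaklyRegular_append_of_maximalIdeal_le_radical {g a b : List R}
    (hlen : a.length = b.length)
    (ham : ∀ x ∈ g ++ a, x ∈ maximalIdeal R) (hbm : ∀ x ∈ b, x ∈ maximalIdeal R)
    (hreg : IsWeaklyRegular R (g ++ a))
    (hrada : maximalIdeal R ≤ (Ideal.ofList (g ++ a)).radical)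
    (hrad : maximalIdeal R ≤ (Ideal.ofList (g ++ b)).radical) :
    IsWeaklyRegular R (g ++ b) := by
  induction a generalizing g b with
  | nil =>
    obtain rfl := List.length_eq_zero_iff.1 hlen.symm
    exact hreg
  | cons a₁ a ih =>
    obtain _ | ⟨b₁, b⟩ := b
    · simp at hlen
    have hperm {x : R} {l : List R} : List.Perm (g ++ x :: l) ((g ++ l) ++ [x]) := by
      rw [List.append_assoc]
      exact (List.perm_append_singleton x l).symm.append_left g
    have hperm' {x : R} {l : List R} : List.Perm ((g ++ l) ++ [x]) ((g ++ [x]) ++ l) := by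
      simpa using hperm.symm
    have hofList {l l' : List R} (h : List.Perm l l') : Ideal.ofList l = Ideal.ofList l' := by
      simp only [Ideal.ofList, h.mem_iff]
    have hlen' : a.length = b.length := by simpa using hlen
    have hlt : (((g ++ a).length : ℕ) : ℕ∞) < (maximalIdeal R).height := by
      refine lt_of_lt_of_le ?_ (length_le_height_maximalIdeal_of_isWeaklyRegular ham hreg)
      norm_cast
      simp
    have hgm : ∀ x ∈ g, x ∈ maximalIdeal R := fun x hx ↦ ham x (by simp [hx])
    have ham' : ∀ x ∈ a, x ∈ maximalIdeal R := fun x hx ↦ ham x (by simp [hx])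
    have ha₁ : a₁ ∈ maximalIdeal R := ham a₁ (by simp)
    have hb₁ : b₁ ∈ maximalIdeal R := hbm b₁ (by simp)
    have hbm' : ∀ x ∈ b, x ∈ maximalIdeal R := fun x hx ↦ hbm x (by simp [hx])
    obtain ⟨w, hwm, hwa, hwb⟩ := exists_mem_maximalIdeal_forall_notMem_minimalPrimes
      (Ideal.ofList (g ++ a)) (Ideal.ofList (g ++ b))
      (maximalIdeal_notMem_minimalPrimes_ofList hlt)
      (maximalIdeal_notMem_minimalPrimes_ofList (by simpa [hlen'] using hlt))
    have hgam : ∀ x ∈ g ++ a, x ∈ maximalIdeal R := by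
      simpa [or_imp, forall_and] using And.intro hgm ham'
    have hgbm : ∀ x ∈ g ++ b, x ∈ maximalIdeal R := by
      simpa [or_imp, forall_and] using And.intro hgm hbm'
    have hmem {l : List R} {x : R} (hl : ∀ y ∈ l, y ∈ maximalIdeal R) (hx : x ∈ maximalIdeal R) :
        ∀ y ∈ l ++ [x], y ∈ maximalIdeal R := by
      simpa [or_imp, forall_and] using And.intro hl hx
    have hradaw := maximalIdeal_le_radical_ofList_append_singleton hgam ha₁
      (by rwa [← hofList hperm]) hwa
    have hradbw := maximalIdeal_le_radical_ofList_append_singleton hgbm hb₁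
      (by rwa [← hofList hperm]) hwb
    have hreg₁ : IsWeaklyRegular R ((g ++ a) ++ [w]) :=
      (isWeaklyRegular_of_perm_of_subset_maximalIdeal hreg hperm
        ham).append_singleton_of_mem_radical (hradaw ha₁)
    have hreg₂ : IsWeaklyRegular R ((g ++ [w]) ++ b) := by
      refine ih hlen' ?_ hbm' ?_ ?_ ?_
      · exact fun x hx ↦ hmem hgam hwm x (hperm'.mem_iff.2 hx)
      · exact isWeaklyRegular_of_perm_of_subset_maximalIdeal hreg₁ hperm' (hmem hgam hwm)
      · rwa [← hofList hperm']
      · rwa [← hofList hperm']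
    have hreg₃ : IsWeaklyRegular R ((g ++ b) ++ [w]) :=
      isWeaklyRegular_of_perm_of_subset_maximalIdeal hreg₂ hperm'.symm
        fun x hx ↦ hmem hgbm hwm x (hperm'.mem_iff.2 hx)
    refine isWeaklyRegular_of_perm_of_subset_maximalIdeal
      (hreg₃.append_singleton_of_mem_radical (a := w) (w := b₁) ?_) hperm.symm (hmem hgbm hb₁)
    rw [← hofList hperm]
    exact hrad hwm
end

section

open RingTheory.Sequence

variable {σ K : Type*} [Field K]

attribute [local instance] MvPolynomial.gradedAlgebra

/-- The graded pieces of the quotient by an ideal of a polynomial ring. -/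
noncomputable def MvPolynomial.quotientGradedPiece (J : Ideal (MvPolynomial σ K)) (ℓ : ℕ) :
    Submodule K (MvPolynomial σ K ⧸ J) :=
  (homogeneousSubmodule σ K ℓ).map (Ideal.Quotient.mkₐ K J).toLinearMap

/-- The Hilbert series of the quotient by an ideal of a polynomial ring. -/
noncomputable def MvPolynomial.quotientHilbertSeries (J : Ideal (MvPolynomial σ K)) :
    PowerSeries ℤ :=
  PowerSeries.mk fun ℓ ↦ (Module.finrank K (quotientGradedPiece J ℓ) : ℤ)

theorem MvPolynomial.mem_quotientGradedPiece {J : Ideal (MvPolynomial σ K)} {ℓ : ℕ}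
    {y : MvPolynomial σ K ⧸ J} :
    y ∈ quotientGradedPiece J ℓ ↔
      ∃ p : MvPolynomial σ K, p.IsHomogeneous ℓ ∧ Ideal.Quotient.mk J p = y :=
  Iff.rfl

instance [Finite σ] (J : Ideal (MvPolynomial σ K)) (ℓ : ℕ) :
    FiniteDimensional K (quotientGradedPiece J ℓ) :=
  Module.Finite.iff_fg.2 ((homogeneousSubmodule_fg σ K ℓ).map _)

theorem MvPolynomial.mem_quotientGradedPiece_and_factor_eq_zero_iff
    {J : Ideal (MvPolynomial σ K)}
    (hJ : J.IsHomogeneous (homogeneousSubmodule σ K)) {f : MvPolynomial σ K} {d : ℕ}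
    (hf : f.IsHomogeneous d) (ℓ : ℕ) (y : MvPolynomial σ K ⧸ J) :
    (y ∈ quotientGradedPiece J ℓ ∧
      Ideal.Quotient.factor (le_sup_left : J ≤ J ⊔ Ideal.span {f}) y = 0) ↔
    if d ≤ ℓ then ∃ z ∈ quotientGradedPiece J (ℓ - d), Ideal.Quotient.mk J f * z = y
      else y = 0 := by
  constructor
  · rintro ⟨hy, h0⟩
    obtain ⟨p, hp, rfl⟩ := mem_quotientGradedPiece.1 hy
    rw [Ideal.Quotient.factor_mk, Ideal.Quotient.eq_zero_iff_mem] at h0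
    obtain ⟨j, hj, w, hw, hjw⟩ := Submodule.mem_sup.1 h0
    obtain ⟨z, rfl⟩ := Ideal.mem_span_singleton.1 hw
    have hdec := congrArg (fun q ↦
      (DirectSum.decompose (homogeneousSubmodule σ K) q ℓ : MvPolynomial σ K)) hjw.symm
    simp only [DirectSum.decompose_add, DirectSum.add_apply, Submodule.coe_add] at hdec
    rw [DirectSum.decompose_of_mem_same (homogeneousSubmodule σ K) (x := p) hp] at hdec
    have hjℓ := hJ.mem_iff.1 hj ℓ
    split_ifs with hd
    · rw [DirectSum.coe_decompose_mul_of_left_mem_of_le _ hf hd] at hdec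
      refine ⟨_, mem_quotientGradedPiece.2 ⟨_, SetLike.coe_mem
        (DirectSum.decompose (homogeneousSubmodule σ K) z (ℓ - d)), rfl⟩, ?_⟩
      rw [hdec, map_add, Ideal.Quotient.eq_zero_iff_mem.2 hjℓ, zero_add, map_mul]
    · rw [DirectSum.coe_decompose_mul_of_left_mem_of_not_le _ hf hd, add_zero] at hdec
      rwa [Ideal.Quotient.eq_zero_iff_mem, hdec]
  · split_ifs with hd
    · rintro ⟨z, hz, rfl⟩
      obtain ⟨q, hq, rfl⟩ := mem_quotientGradedPiece.1 hz
      rw [← map_mul, Ideal.Quotient.factor_mk, Ideal.Quotient.eq_zero_iff_mem]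
      refine ⟨mem_quotientGradedPiece.2 ⟨_, ?_, rfl⟩, ?_⟩
      · have := hf.mul hq
        rwa [Nat.add_sub_cancel' hd] at this
      · exact Ideal.mem_sup_right (Ideal.mul_mem_right _ _ (Ideal.mem_span_singleton_self f))
    · rintro rfl
      exact ⟨zero_mem _, map_zero _⟩

theorem MvPolynomial.finrank_quotientGradedPiece_sup_span [Finite σ]
    {J : Ideal (MvPolynomial σ K)}
    (hJ : J.IsHomogeneous (homogeneousSubmodule σ K)) {f : MvPolynomial σ K} {d : ℕ}
    (hf : f.IsHomogeneous d) (hreg : IsSMulRegular (MvPolynomial σ K ⧸ J) f) (ℓ : ℕ) :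
    Module.finrank K (quotientGradedPiece (J ⊔ Ideal.span {f}) ℓ) +
      (if d ≤ ℓ then Module.finrank K (quotientGradedPiece J (ℓ - d)) else 0) =
      Module.finrank K (quotientGradedPiece J ℓ) := by
  let φ : (MvPolynomial σ K ⧸ J) →ₗ[K] (MvPolynomial σ K ⧸ (J ⊔ Ideal.span {f})) :=
    (Ideal.Quotient.factorₐ K le_sup_left).toLinearMap
  let W := quotientGradedPiece J ℓ
  have hrange : W.map φ = quotientGradedPiece (J ⊔ Ideal.span {f}) ℓ :=
    (Submodule.map_comp _ _ _).symm
  have hker : (φ.domRestrict W).ker.map W.subtype = W ⊓ φ.ker := by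
    rw [LinearMap.ker_domRestrict, Submodule.map_comap_subtype]
  have hmem (y) : y ∈ W ⊓ φ.ker ↔ _ :=
    mem_quotientGradedPiece_and_factor_eq_zero_iff hJ hf ℓ y
  rw [← LinearMap.finrank_range_add_finrank_ker (φ.domRestrict W), LinearMap.range_domRestrict,
    hrange, ← Submodule.finrank_map_subtype_eq _ (φ.domRestrict W).ker, hker]
  congr 1
  split_ifs with hd
  · have hinj : Function.Injective (LinearMap.mulLeft K (Ideal.Quotient.mk J f)) :=
      fun y z hyz ↦ hreg (by simpa only [Algebra.smul_def] using! hyz)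
    have hmul : (quotientGradedPiece J (ℓ - d)).map
        (LinearMap.mulLeft K (Ideal.Quotient.mk J f)) = W ⊓ φ.ker := by
      ext y
      rw [hmem, if_pos hd]
      rfl
    rw [← hmul, ← (Submodule.equivMapOfInjective _ hinj _).finrank_eq]
  · have hbot : W ⊓ φ.ker = ⊥ := by
      rw [eq_bot_iff]
      intro y hy
      rw [hmem, if_neg hd] at hy
      exact hy
    rw [hbot, finrank_bot]

theorem MvPolynomial.quotientHilbertSeries_sup_span [Finite σ]
    {J : Ideal (MvPolynomial σ K)}
    (hJ : J.IsHomogeneous (homogeneousSubmodule σ K)) {f : MvPolynomial σ K} {d : ℕ}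
    (hf : f.IsHomogeneous d) (hreg : IsSMulRegular (MvPolynomial σ K ⧸ J) f) :
    quotientHilbertSeries (J ⊔ Ideal.span {f}) =
      (1 - PowerSeries.X ^ d) * quotientHilbertSeries J := by
  ext ℓ
  rw [sub_mul, one_mul, map_sub, PowerSeries.coeff_X_pow_mul']
  simp only [quotientHilbertSeries, PowerSeries.coeff_mk]
  rw [← finrank_quotientGradedPiece_sup_span hJ hf hreg ℓ]
  push_cast
  ring

theorem MvPolynomial.isHomogeneous_ofList {l : List (MvPolynomial σ K)}
    (hl : ∀ f ∈ l, ∃ d, f.IsHomogeneous d) :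
    (Ideal.ofList l).IsHomogeneous (homogeneousSubmodule σ K) :=
  Ideal.homogeneous_span _ _ hl

theorem MvPolynomial.quotientHilbertSeries_ofList_ofFn [Finite σ] {k : ℕ}
    {f : Fin k → MvPolynomial σ K} {d : Fin k → ℕ} (hf : ∀ i, (f i).IsHomogeneous (d i))
    (hreg : IsWeaklyRegular (MvPolynomial σ K) (List.ofFn f)) :
    quotientHilbertSeries (Ideal.ofList (List.ofFn f)) =
      (∏ i, (1 - PowerSeries.X ^ d i)) *
        quotientHilbertSeries (⊥ : Ideal (MvPolynomial σ K)) := by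
  induction k with
  | zero => simp
  | succ k ih =>
    rw [List.ofFn_succ', List.concat_eq_append] at hreg ⊢
    rw [isWeaklyRegular_append_iff, isWeaklyRegular_singleton_iff] at hreg
    have htop : Ideal.ofList (List.ofFn fun i ↦ f i.castSucc) •
        (⊤ : Submodule (MvPolynomial σ K) (MvPolynomial σ K)) =
          Ideal.ofList (List.ofFn fun i ↦ f i.castSucc) := Ideal.mul_top _
    rw [htop] at hreg
    rw [Ideal.ofList_append, Ideal.ofList_singleton,
      quotientHilbertSeries_sup_span (isHomogeneous_ofList ?_) (hf _) hreg.2,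
      ih (fun i ↦ hf i.castSucc) hreg.1, Fin.prod_univ_castSucc]
    · ring
    · intro p hp
      obtain ⟨i, rfl⟩ := (List.mem_ofFn' _ _).1 hp
      exact ⟨_, hf _⟩

theorem MvPolynomial.mem_of_mul_mem_of_constantCoeff_ne_zero
    {J : Ideal (MvPolynomial σ K)}
    (hJ : J.IsHomogeneous (homogeneousSubmodule σ K)) {s p : MvPolynomial σ K} {e : ℕ}
    (hs : constantCoeff s ≠ 0) (hp : p.IsHomogeneous e) (hsp : s * p ∈ J) : p ∈ J := by
  have h := hJ.mem_iff.1 hsp (0 + e)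
  rw [DirectSum.coe_decompose_mul_add_of_right_mem (homogeneousSubmodule σ K) (b := p) hp] at h
  have h0 : (DirectSum.decompose (homogeneousSubmodule σ K) s 0 : MvPolynomial σ K) =
      C (constantCoeff s) :=
    (decomposition.decompose'_apply s 0).trans (homogeneousComponent_zero s)
  rw [h0] at h
  have := J.mul_mem_left (C (constantCoeff s)⁻¹) h
  rwa [← mul_assoc, ← C_mul, inv_mul_cancel₀ hs, C_1, one_mul] at this

/-- A sequence of homogeneous polynomials is weakly regular if it is so after localizing at the
ideal of polynomials vanishing at the origin. -/
theorem MvPolynomial.isWeaklyRegular_of_isLocalization (A : Type*) [CommRing A]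
    [Algebra (MvPolynomial σ K) A] (T : Submonoid (MvPolynomial σ K)) [IsLocalization T A]
    (hT : ∀ s ∈ T, constantCoeff s ≠ 0) {l : List (MvPolynomial σ K)}
    (hl : ∀ f ∈ l, ∃ d, f.IsHomogeneous d)
    (hreg : IsWeaklyRegular A (l.map (algebraMap (MvPolynomial σ K) A))) :
    IsWeaklyRegular (MvPolynomial σ K) l := by
  constructor
  intro i hi
  have h := hreg.regular_mod_prev i (by simpa using hi)
  rw [List.getElem_map, ← List.map_take, ← Ideal.map_ofList] at h
  obtain ⟨d, hd⟩ := hl l[i] (List.getElem_mem hi)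
  have hJ := isHomogeneous_ofList fun f hf ↦ hl f (List.mem_of_mem_take (i := i) hf)
  rw [isSMulRegular_quotient_iff_mem_of_smul_mem]
  simp only [smul_eq_mul, Ideal.mul_top]
  intro x hx
  rw [hJ.mem_iff]
  intro e
  have hxe := hJ.mem_iff.1 hx (d + e)
  rw [DirectSum.coe_decompose_mul_add_of_left_mem (homogeneousSubmodule σ K) (a := l[i]) hd]
    at hxe
  set y := (DirectSum.decompose (homogeneousSubmodule σ K) x e : MvPolynomial σ K)
  have hy : algebraMap (MvPolynomial σ K) A y ∈
      (Ideal.ofList (l.take i)).map (algebraMap (MvPolynomial σ K) A) := by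
    have := mem_of_isSMulRegular_quotient_of_smul_mem h
      (x := algebraMap (MvPolynomial σ K) A y)
    simp only [smul_eq_mul, Ideal.mul_top, ← map_mul] at this
    exact this (Ideal.mem_map_of_mem _ hxe)
  obtain ⟨s, hs, hsy⟩ := (IsLocalization.algebraMap_mem_map_algebraMap_iff T A _ _).1 hy
  exact mem_of_mul_mem_of_constantCoeff_ne_zero hJ (hT s hs)
    (SetLike.coe_mem (DirectSum.decompose (homogeneousSubmodule σ K) x e)) hsy

theorem MvPolynomial.ker_constantCoeff_eq_span_range_X :
    RingHom.ker (constantCoeff : MvPolynomial σ K →+* K) =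
      Ideal.span (Set.range (X : σ → MvPolynomial σ K)) := by
  ext p
  rw [← Set.image_univ, mem_ideal_span_X_image, RingHom.mem_ker, constantCoeff_eq]
  constructor
  · intro h m hm
    by_contra! hm0
    obtain rfl : m = 0 := Finsupp.ext fun i ↦ hm0 i (Set.mem_univ i)
    exact mem_support_iff.1 hm h
  · intro h
    by_contra h0
    obtain ⟨i, -, hi⟩ := h 0 (mem_support_iff.2 h0)
    exact hi rfl

theorem MvPolynomial.isWeaklyRegular_ofFn_X (k : ℕ) :
    IsWeaklyRegular (MvPolynomial (Fin k) K)
      (List.ofFn (X : Fin k → MvPolynomial (Fin k) K)) := by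
  constructor
  intro i hi
  have hik : i < k := by simpa using hi
  have hspan : Ideal.ofList ((List.ofFn (X : Fin k → MvPolynomial (Fin k) K)).take i) =
      Ideal.span (X '' {j | j.1 < i}) := by
    unfold Ideal.ofList
    congr 1
    ext p
    simp only [Set.mem_ofPred_eq, List.mem_take_iff_getElem, List.length_ofFn, Set.mem_image,
      List.getElem_ofFn]
    constructor
    · rintro ⟨j, hj, rfl⟩
      exact ⟨⟨j, by omega⟩, by simp; omega, rfl⟩
    · rintro ⟨j, hj, rfl⟩
      exact ⟨j, by simp; omega, rfl⟩
  rw [isSMulRegular_quotient_iff_mem_of_smul_mem]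
  simp only [smul_eq_mul, Ideal.mul_top, List.getElem_ofFn, hspan]
  intro p hp
  rw [mem_ideal_span_X_image] at hp ⊢
  intro m hm
  obtain ⟨j, hj, hjm⟩ := hp (Finsupp.single ⟨i, hik⟩ 1 + m) (by
    rw [mem_support_iff, coeff_X_mul]
    exact mem_support_iff.1 hm)
  refine ⟨j, hj, ?_⟩
  have hne : (⟨i, hik⟩ : Fin k) ≠ j := by
    rintro rfl
    exact lt_irrefl i (show i < i from hj)
  simpa [Finsupp.single_apply, hne] using hjm

theorem MvPolynomial.quotientHilbertSeries_span_range_X [Finite σ] :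
    quotientHilbertSeries (Ideal.span (Set.range (X : σ → MvPolynomial σ K))) = 1 := by
  rw [← ker_constantCoeff_eq_span_range_X]
  ext ℓ
  rw [quotientHilbertSeries, PowerSeries.coeff_mk, PowerSeries.coeff_one]
  split_ifs with h
  · subst h
    have : quotientGradedPiece (RingHom.ker (constantCoeff : MvPolynomial σ K →+* K)) 0 =
        K ∙ 1 := by
      rw [quotientGradedPiece, homogeneousSubmodule_zero, Submodule.one_eq_span,
        Submodule.map_span]
      simp
    rw [this, finrank_span_singleton, Nat.cast_one]
    rw [← map_one (Ideal.Quotient.mk _), Ne, Ideal.Quotient.eq_zero_iff_mem]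
    simp
  · have : quotientGradedPiece (RingHom.ker (constantCoeff : MvPolynomial σ K →+* K)) ℓ = ⊥ := by
      rw [eq_bot_iff]
      intro y hy
      obtain ⟨p, hp, rfl⟩ := mem_quotientGradedPiece.1 hy
      rw [Submodule.mem_bot, Ideal.Quotient.eq_zero_iff_mem, RingHom.mem_ker, constantCoeff_eq]
      exact hp.coeff_eq_zero (by simpa using Ne.symm h)
    rw [this, finrank_bot, Nat.cast_zero]

/-- Homogeneous polynomials of positive degree, as many as there are variables, form a weakly
regular sequence if they have no common zero other than the origin. -/
theorem MvPolynomial.isWeaklyRegular_ofFn_of_span_range_X_le_radical {k : ℕ}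
    {f : Fin k → MvPolynomial (Fin k) K} {d : Fin k → ℕ} (hd : ∀ i, 0 < d i)
    (hf : ∀ i, (f i).IsHomogeneous (d i))
    (hrad : Ideal.span (Set.range X) ≤ (Ideal.ofList (List.ofFn f)).radical) :
    IsWeaklyRegular (MvPolynomial (Fin k) K) (List.ofFn f) := by
  let m : Ideal (MvPolynomial (Fin k) K) := RingHom.ker constantCoeff
  have hm : m.IsPrime := RingHom.ker_isPrime _
  have hmX : m = Ideal.ofList (List.ofFn (X : Fin k → MvPolynomial (Fin k) K)) := by
    refine ker_constantCoeff_eq_span_range_X.trans ?_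
    simp only [Ideal.ofList, List.mem_ofFn]
    rfl
  let A := Localization.AtPrime m
  let φ := algebraMap (MvPolynomial (Fin k) K) A
  have hmap : m.map φ = IsLocalRing.maximalIdeal A :=
    IsLocalization.AtPrime.map_eq_maximalIdeal m A
  have hmem {l : List (MvPolynomial (Fin k) K)} (hl : ∀ x ∈ l, x ∈ m) :
      ∀ x ∈ l.map φ, x ∈ IsLocalRing.maximalIdeal A := by
    intro x hx
    obtain ⟨y, hy, rfl⟩ := List.mem_map.1 hx
    rw [← hmap]
    exact Ideal.mem_map_of_mem _ (hl y hy)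
  have : IsNoetherianRing A := IsLocalization.isNoetherianRing m.primeCompl A inferInstance
  refine isWeaklyRegular_of_isLocalization A m.primeCompl (fun s hs ↦ hs) ?_ ?_
  · intro p hp
    obtain ⟨i, rfl⟩ := (List.mem_ofFn' _ _).1 hp
    exact ⟨_, hf i⟩
  · rw [← List.nil_append (List.map _ _)]
    refine IsLocalRing.isWeaklyRegular_append_of_maximalIdeal_le_radical
      (a := (List.ofFn (X : Fin k → MvPolynomial (Fin k) K)).map φ) (by simp) ?_ ?_ ?_ ?_ ?_
    · refine hmem fun x hx ↦ ?_
      rw [hmX]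
      exact Ideal.subset_span hx
    · refine hmem fun x hx ↦ ?_
      obtain ⟨i, rfl⟩ := (List.mem_ofFn' _ _).1 hx
      rw [RingHom.mem_ker, constantCoeff_eq]
      exact (hf i).coeff_eq_zero (by simpa using (hd i).ne)
    · exact (isWeaklyRegular_ofFn_X k).of_isLocalization A m.primeCompl
    · rw [List.nil_append, ← Ideal.map_ofList, ← hmX, hmap]
      exact Ideal.le_radical
    · rw [List.nil_append, ← Ideal.map_ofList, ← hmap]
      refine (Ideal.map_mono ?_).trans (Ideal.map_radical_le _)
      exact ker_constantCoeff_eq_span_range_X.trans_le hrad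

theorem MvPolynomial.span_range_X_le_radical_of_forall_aeval_eq_zero {σ ι : Type*} [Finite σ]
    (L : Type*) [Field L] [IsAlgClosed L] [Algebra K L] {f : ι → MvPolynomial σ K}
    (hzero : ∀ x : σ → L, (∀ i, aeval x (f i) = 0) → x = 0) :
    Ideal.span (Set.range X) ≤ (Ideal.span (Set.range f)).radical := by
  rw [← vanishingIdeal_zeroLocus_eq_radical (K := L), Ideal.span_le]
  rintro _ ⟨i, rfl⟩ x hx
  have hx0 : x = 0 := hzero x fun j ↦ hx (f j) (Ideal.subset_span ⟨j, rfl⟩)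
  simp [hx0]

theorem MvPolynomial.quotientHilbertSeries_span_range {k : ℕ}
    {f : Fin k → MvPolynomial (Fin k) K} {d : Fin k → ℕ} (hd : ∀ i, 0 < d i)
    (hf : ∀ i, (f i).IsHomogeneous (d i))
    (hrad : Ideal.span (Set.range X) ≤ (Ideal.span (Set.range f)).radical) :
    quotientHilbertSeries (Ideal.span (Set.range f)) =
      ∏ i, ∑ j ∈ Finset.range (d i), (PowerSeries.X : PowerSeries ℤ) ^ j := by
  have hspan (g : Fin k → MvPolynomial (Fin k) K) :
      Ideal.span (Set.range g) = Ideal.ofList (List.ofFn g) := by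
    simp only [Ideal.ofList, List.mem_ofFn]
    rfl
  have hX := quotientHilbertSeries_ofList_ofFn (K := K) (fun i : Fin k ↦ isHomogeneous_X K i)
    (isWeaklyRegular_ofFn_X k)
  rw [← hspan, quotientHilbertSeries_span_range_X] at hX
  rw [hspan f] at hrad ⊢
  rw [quotientHilbertSeries_ofList_ofFn hf
    (isWeaklyRegular_ofFn_of_span_range_X_le_radical hd hf hrad)]
  simp only [← geom_sum_mul_neg, Finset.prod_mul_distrib, mul_assoc]
  simp only [pow_one] at hX
  rw [← hX, mul_one]

end

/-- Macaulay's theorem (Lemma 3.2 of the paper): if `h_0, …, h_n ∈ K[x_0,…,x_n]` are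
homogeneous of positive degrees with no common zero in `ℙ^n` over an algebraic closure of
`K` (i.e. their only common affine zero is the origin), then for every `ℓ ≥ 0` the
`K`-dimension `δ_ℓ` of the degree-`ℓ` graded piece of `K[x]/⟨h_0,…,h_n⟩` equals the
coefficient of `t^ℓ` in `∏_{i=0}^n (1 + t + ⋯ + t^{deg h_i - 1}) ∈ ℤ[t]`. -/
theorem macaulay_hilbert_series (K : Type*) [Field K] (n : ℕ)
    (h : Fin (n + 1) → MvPolynomial (Fin (n + 1)) K) (deg : Fin (n + 1) → ℕ)
    (hpos : ∀ i, 0 < deg i) (hhom : ∀ i, (h i).IsHomogeneous (deg i))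
    (hzero : ∀ x : Fin (n + 1) → AlgebraicClosure K,
      (∀ i, MvPolynomial.aeval x (h i) = 0) → x = 0)
    (ℓ : ℕ) :
    (Module.finrank K
        (Submodule.map (Ideal.Quotient.mkₐ K (Ideal.span (Set.range h))).toLinearMap
          (homogeneousSubmodule (Fin (n + 1)) K ℓ)) : ℤ) =
      (∏ i : Fin (n + 1), ∑ j ∈ Finset.range (deg i),
        (Polynomial.X : Polynomial ℤ) ^ j).coeff ℓ := by
  have hH := congrArg (PowerSeries.coeff ℓ) (quotientHilbertSeries_span_range hpos hhom
    (span_range_X_le_radical_of_forall_aeval_eq_zero _ hzero))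
  rw [quotientHilbertSeries, PowerSeries.coeff_mk] at hH
  refine hH.trans ?_
  rw [← Polynomial.coeff_coe]
  congr 1
  simp only [← Polynomial.coeToPowerSeries.ringHom_apply, map_prod, map_sum, map_pow]
  simp
end

section
/- For every integer m ≥ 0, every integer ℓ ≥ d, and every v ∈ ℤ^{n+1} of degree dm + ℓ, the restriction F^m|_{D(v,ℓ)} of the polynomial F^m to the monomial set D(v,ℓ) lies in ℰ_{v,ℓ}. -/
noncomputable section

open MvPolynomial

/-- The finset `D_ℓ` of exponent vectors in `ℤ_{≥0}^{n+1}` of total degree `ℓ`,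
realized as integer vectors. -/
def Dfin (n ℓ : ℕ) : Finset (Fin (n + 1) → ℤ) :=
  (Finset.Nat.antidiagonalTuple (n + 1) ℓ).image fun t i => (t i : ℤ)

/-- The inverted simplex `D(v,ℓ) = {v - w : w ∈ D_ℓ}`. -/
def Dv {n : ℕ} (v : Fin (n + 1) → ℤ) (ℓ : ℕ) : Finset (Fin (n + 1) → ℤ) :=
  (Dfin n ℓ).image fun w => v - w

/-- The coefficient of a polynomial at an integer exponent vector (zero if some exponent
is negative). -/
def coeffZ {K : Type*} [Field K] {n : ℕ} (F : MvPolynomial (Fin (n + 1)) K)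
    (u : Fin (n + 1) → ℤ) : K :=
  if ∀ i, 0 ≤ u i then
    MvPolynomial.coeff (Finsupp.equivFunOnFinite.symm fun i => (u i).toNat) F
  else 0

/-- The linear functional
`G ↦ Σ_{t ∈ D_d} ((v_i - s_i) - (m+1)·t_i) · F_t · G_{v-s-t}`, i.e. the difference of the
two sides of the defining equation of `ℰ_{v,ℓ}` at `(s,i)`. -/
def eqFun {K : Type*} [Field K] {n : ℕ} (F : MvPolynomial (Fin (n + 1)) K) (d m : ℕ)
    (v s : Fin (n + 1) → ℤ) (i : Fin (n + 1)) : ((Fin (n + 1) → ℤ) →₀ K) →ₗ[K] K :=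
  ∑ t ∈ Dfin n d,
    ((((v i - s i : ℤ) : K) - ((m : K) + 1) * ((t i : ℤ) : K)) * coeffZ F t) •
      (Finsupp.lapply (v - s - t) : ((Fin (n + 1) → ℤ) →₀ K) →ₗ[K] K)

/-- The space `ℰ_{v,ℓ}`: Laurent polynomials `G` supported on `D(v,ℓ)` such that for every
`s ∈ D_{ℓ-d}` and every `i ∈ {0,…,n}`,
`(v_i - s_i) Σ_{t∈D_d} F_t G_{v-s-t} = (m+1) Σ_{t∈D_d} t_i F_t G_{v-s-t}`. -/
def Espace {K : Type*} [Field K] {n : ℕ} (F : MvPolynomial (Fin (n + 1)) K) (d m : ℕ)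
    (v : Fin (n + 1) → ℤ) (ℓ : ℕ) : Submodule K ((Fin (n + 1) → ℤ) →₀ K) :=
  Finsupp.supported K K ↑(Dv v ℓ) ⊓
    ⨅ s ∈ Dfin n (ℓ - d), ⨅ i : Fin (n + 1), LinearMap.ker (eqFun F d m v s i)

/-- Restriction `G|_S` of a Laurent polynomial to a finite set of monomials. -/
def restrictF {K : Type*} [Field K] {n : ℕ} (G : (Fin (n + 1) → ℤ) →₀ K)
    (S : Finset (Fin (n + 1) → ℤ)) : (Fin (n + 1) → ℤ) →₀ K :=
  ∑ u ∈ S, Finsupp.single u (G u)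

/-- Restriction `F|_S` of a polynomial to a finite set of (integer) monomials, as a Laurent
polynomial. -/
def restrictPoly {K : Type*} [Field K] {n : ℕ} (F : MvPolynomial (Fin (n + 1)) K)
    (S : Finset (Fin (n + 1) → ℤ)) : (Fin (n + 1) → ℤ) →₀ K :=
  ∑ u ∈ S, Finsupp.single u (coeffZ F u)

/-- The coefficient of the product `F·G` at the integer exponent vector `w`, where `F` is a
polynomial and `G` a Laurent polynomial. -/
def mulCoeffZ {K : Type*} [Field K] {n : ℕ} (F : MvPolynomial (Fin (n + 1)) K)
    (G : (Fin (n + 1) → ℤ) →₀ K) (w : Fin (n + 1) → ℤ) : K :=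
  ∑ t ∈ F.support, MvPolynomial.coeff t F * G fun i => w i - (t i : ℤ)

lemma natCast_mem_Dfin {n ℓ : ℕ} (t : Fin (n + 1) →₀ ℕ) :
    (fun i => (t i : ℤ)) ∈ Dfin n ℓ ↔ t.degree = ℓ := by
  simp only [Dfin, Finset.mem_image, Finset.Nat.mem_antidiagonalTuple, Finsupp.degree_eq_sum]
  constructor
  · rintro ⟨w, hw, hwt⟩
    rw [← hw]
    exact Finset.sum_congr rfl fun i _ => by exact_mod_cast (congrFun hwt i).symm
  · exact fun h => ⟨t, h, rfl⟩

lemma mem_Dfin {n ℓ : ℕ} {u : Fin (n + 1) → ℤ} :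
    u ∈ Dfin n ℓ ↔ (∀ i, 0 ≤ u i) ∧ ∑ i, u i = ℓ := by
  simp only [Dfin, Finset.mem_image, Finset.Nat.mem_antidiagonalTuple]
  constructor
  · rintro ⟨w, hw, rfl⟩
    exact ⟨fun i => Int.natCast_nonneg _, by
      beta_reduce
      exact_mod_cast hw⟩
  · rintro ⟨h0, h1⟩
    lift u to Fin (n + 1) → ℕ using h0
    exact ⟨u, by
      beta_reduce at h1
      exact_mod_cast h1, rfl⟩

lemma coeffZ_natCast {K : Type*} [Field K] {n : ℕ} (F : MvPolynomial (Fin (n + 1)) K)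
    (t : Fin (n + 1) →₀ ℕ) : coeffZ F (fun i => (t i : ℤ)) = F.coeff t := by
  have : Finsupp.equivFunOnFinite.symm (fun i => t i) = t := by ext; simp
  simp [coeffZ, this]

lemma coeffZ_of_neg {K : Type*} [Field K] {n : ℕ} (F : MvPolynomial (Fin (n + 1)) K)
    {u : Fin (n + 1) → ℤ} {i : Fin (n + 1)} (hi : u i < 0) : coeffZ F u = 0 :=
  if_neg fun h => (h i).not_gt hi

lemma exists_natCast_eq {n : ℕ} {u : Fin (n + 1) → ℤ} (hu : ∀ i, 0 ≤ u i) :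
    ∃ t : Fin (n + 1) →₀ ℕ, (fun i => (t i : ℤ)) = u :=
  ⟨Finsupp.equivFunOnFinite.symm fun i => (u i).toNat, by ext i; simp [hu i]⟩

lemma MvPolynomial.coeff_X_mul_pderiv {R σ : Type*} [CommSemiring R] (i : σ)
    (p : MvPolynomial σ R) (t : σ →₀ ℕ) :
    (X i * pderiv i p).coeff t = t i * p.coeff t := by
  classical
  induction p using MvPolynomial.induction_on' with
  | monomial m r =>
    rw [X_mul_pderiv_monomial, coeff_smul, coeff_monomial, nsmul_eq_mul]
    split_ifs with h
    · rw [h]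
    · simp
  | add p q hp hq => rw [map_add, mul_add, coeff_add, coeff_add, hp, hq, mul_add]

lemma coeffZ_X_mul_pderiv {K : Type*} [Field K] {n : ℕ} (i : Fin (n + 1))
    (F : MvPolynomial (Fin (n + 1)) K) (u : Fin (n + 1) → ℤ) :
    coeffZ (X i * pderiv i F) u = (u i : K) * coeffZ F u := by
  by_cases hu : ∀ i, 0 ≤ u i
  · obtain ⟨t, rfl⟩ := exists_natCast_eq hu
    simp [coeffZ_natCast, coeff_X_mul_pderiv]
  · obtain ⟨j, hj⟩ := not_forall.mp hu
    simp [coeffZ_of_neg _ (not_le.mp hj)]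

/-- The coefficients of a product whose first factor is homogeneous, as a convolution over
integer exponent vectors. -/
lemma MvPolynomial.IsHomogeneous.sum_coeffZ_mul {K : Type*} [Field K] {n d : ℕ}
    {A : MvPolynomial (Fin (n + 1)) K} (hA : A.IsHomogeneous d)
    (B : MvPolynomial (Fin (n + 1)) K) (u : Fin (n + 1) → ℤ) :
    ∑ t ∈ Dfin n d, coeffZ A t * coeffZ B (u - t) = coeffZ (A * B) u := by
  by_cases hu : ∀ i, 0 ≤ u i
  · obtain ⟨w, rfl⟩ := exists_natCast_eq hu
    rw [coeffZ_natCast, coeff_mul]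
    have cast_sub (p : (Fin (n + 1) →₀ ℕ) × (Fin (n + 1) →₀ ℕ)) (hp : p.1 + p.2 = w) :
        ((fun i => (w i : ℤ)) - fun i => (p.1 i : ℤ)) = fun i => (p.2 i : ℤ) := by
      ext i
      simp [← hp]
    symm
    refine Finset.sum_bij_ne_zero (fun p _ _ i => (p.1 i : ℤ)) ?_ ?_ ?_ ?_
    · intro p _ hp
      rw [natCast_mem_Dfin]
      by_contra hdeg
      exact left_ne_zero_of_mul hp (hA.coeff_eq_zero hdeg)
    · intro p hp _ q hq _ h
      have h1 : p.1 = q.1 := by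
        ext i
        exact_mod_cast congrFun h i
      rw [Finset.HasAntidiagonal.mem_antidiagonal] at hp hq
      refine Prod.ext h1 (add_left_cancel (a := p.1) ?_)
      rw [hp, h1, hq]
    · intro t ht hne
      obtain ⟨t, rfl⟩ := exists_natCast_eq (mem_Dfin.mp ht).1
      have hle : t ≤ w := by
        intro i
        by_contra! hi
        exact hne (mul_eq_zero_of_right _ (coeffZ_of_neg B (i := i) (by simpa using hi)))
      have hadd : t + (w - t) = w := add_tsub_cancel_of_le hle
      refine ⟨(t, w - t), by simpa using hadd, ?_, rfl⟩
      rwa [cast_sub (t, w - t) hadd, coeffZ_natCast, coeffZ_natCast] at hne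
    · intro p hp _
      rw [cast_sub p (Finset.HasAntidiagonal.mem_antidiagonal.mp hp), coeffZ_natCast, coeffZ_natCast]
  · obtain ⟨j, hj⟩ := not_forall.mp hu
    rw [coeffZ_of_neg _ (not_le.mp hj)]
    refine Finset.sum_eq_zero fun t ht => mul_eq_zero_of_right _ (coeffZ_of_neg B (i := j) ?_)
    have := (mem_Dfin.mp ht).1 j
    rw [Pi.sub_apply]
    lia

lemma restrictPoly_apply {K : Type*} [Field K] {n : ℕ} (F : MvPolynomial (Fin (n + 1)) K)
    {S : Finset (Fin (n + 1) → ℤ)} {u : Fin (n + 1) → ℤ} (hu : u ∈ S) :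
    restrictPoly F S u = coeffZ F u := by
  classical
  simp [restrictPoly, Finsupp.finsetSum_apply, Finsupp.single_apply, hu]

lemma restrictPoly_mem_supported {K : Type*} [Field K] {n : ℕ}
    (F : MvPolynomial (Fin (n + 1)) K) (S : Finset (Fin (n + 1) → ℤ)) :
    restrictPoly F S ∈ Finsupp.supported K K (S : Set (Fin (n + 1) → ℤ)) :=
  Submodule.sum_mem _ fun _ hu => Finsupp.single_mem_supported K _ hu

lemma sub_sub_mem_Dv {n d ℓ : ℕ} (hℓ : d ≤ ℓ) (v : Fin (n + 1) → ℤ)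
    {s t : Fin (n + 1) → ℤ} (hs : s ∈ Dfin n (ℓ - d)) (ht : t ∈ Dfin n d) :
    v - s - t ∈ Dv v ℓ := by
  rw [mem_Dfin] at hs ht
  refine Finset.mem_image.mpr ⟨s + t, mem_Dfin.mpr ⟨fun i => add_nonneg (hs.1 i) (ht.1 i), ?_⟩,
    (sub_sub v s t).symm⟩
  simp only [Pi.add_apply, Finset.sum_add_distrib, hs.2, ht.2]
  lia

lemma MvPolynomial.IsHomogeneous.X_mul_pderiv {R σ : Type*} [CommSemiring R] {d : ℕ}
    {F : MvPolynomial σ R} (hF : F.IsHomogeneous d) (i : σ) :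
    (X i * pderiv i F).IsHomogeneous d := by
  intro t ht
  rw [coeff_X_mul_pderiv] at ht
  exact hF (right_ne_zero_of_mul ht)

/-- The logarithmic derivative identity `x_i ∂_i F^{m+1} = (m+1) (x_i ∂_i F) F^m`, read off
coefficientwise. -/
lemma MvPolynomial.IsHomogeneous.sum_coeffZ_pow {K : Type*} [Field K] {n d : ℕ}
    {F : MvPolynomial (Fin (n + 1)) K} (hF : F.IsHomogeneous d) (m : ℕ)
    (u : Fin (n + 1) → ℤ) (i : Fin (n + 1)) :
    ∑ t ∈ Dfin n d, ((u i : K) - (m + 1) * (t i : K)) * coeffZ F t * coeffZ (F ^ m) (u - t)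
      = 0 := by
  have hpow := hF.sum_coeffZ_mul (F ^ m) u
  have hderiv := (hF.X_mul_pderiv i).sum_coeffZ_mul (F ^ m) u
  have hleib : coeffZ (X i * pderiv i (F ^ (m + 1))) u
      = ((m : K) + 1) * coeffZ (X i * pderiv i F * F ^ m) u := by
    have : X i * pderiv i (F ^ (m + 1)) = C ((m : K) + 1) * (X i * pderiv i F * F ^ m) := by
      rw [pderiv_pow, Nat.add_sub_cancel]
      push_cast [map_add, map_natCast, map_one]
      ring
    simp only [this, coeffZ, coeff_C_mul, mul_ite, mul_zero]
  rw [coeffZ_X_mul_pderiv, pow_succ', ← hpow, ← hderiv] at hleib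
  rw [← sub_eq_zero, Finset.mul_sum, Finset.mul_sum, ← Finset.sum_sub_distrib] at hleib
  rw [← hleib]
  refine Finset.sum_congr rfl fun t _ => ?_
  rw [coeffZ_X_mul_pderiv]
  ring

/-- For every `m ≥ 0`, every `ℓ ≥ d`, and every `v ∈ ℤ^{n+1}` of degree `dm + ℓ`, the
restriction `F^m|_{D(v,ℓ)}` lies in `ℰ_{v,ℓ}`. -/
theorem restrict_pow_mem_Espace {K : Type*} [Field K] (n : ℕ) (hn : 1 ≤ n)
    (d : ℕ) (hd : 2 ≤ d) (hdK : (d : K) ≠ 0)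
    (F : MvPolynomial (Fin (n + 1)) K) (hF : F.IsHomogeneous d)
    (m ℓ : ℕ) (hℓ : d ≤ ℓ) (v : Fin (n + 1) → ℤ)
    (hv : (∑ i, v i) = ((d * m + ℓ : ℕ) : ℤ)) :
    restrictPoly (F ^ m) (Dv v ℓ) ∈ Espace F d m v ℓ := by
  refine Submodule.mem_inf.mpr ⟨restrictPoly_mem_supported _ _, ?_⟩
  simp only [Submodule.mem_iInf, LinearMap.mem_ker]
  intro s hs i
  rw [← hF.sum_coeffZ_pow m (v - s) i, eqFun, LinearMap.sum_apply]
  refine Finset.sum_congr rfl fun t ht => ?_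
  rw [LinearMap.smul_apply, Finsupp.lapply_apply, smul_eq_mul,
    restrictPoly_apply _ (sub_sub_mem_Dv hℓ v hs ht), Pi.sub_apply]
end
end
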